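/- Let d ≥ 1 and let X be an ℝ^d-valued random vector with Pr(X ≠ 0) > 0 and E[ln(1+‖X‖)] < ∞. Then the function g(P) = E[ln(1+‖X‖²/P²)] is continuous and strictly decreasing on (0, ∞), g(P) → +∞ as P → 0⁺, and g(P) → 0 as P → +∞. Consequently, since c_d > 0, there exists a unique P* > 0 with E[ln(1+‖X‖²/(P*)²)] = c_d, i.e., the 1-power P₁(X) exists, is unique and is strictly positive; and for X = 0 (almost surely) one sets P₁(X) = 0. (This is Property (i) of the paper's α-power, together with the continuity/monotonicity and limit lemmas of its Appendix, specialized to the Cauchy reference α = 1.) -/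

import Mathlib

open MeasureTheory ProbabilityTheory Real Filter Topology

/-- The standard `d`-dimensional isotropic Cauchy density. -/
noncomputable def pC (d : ℕ) (x : EuclideanSpace ℝ (Fin d)) : ℝ :=
  Real.Gamma (((d : ℝ) + 1) / 2) * Real.pi ^ (-((d : ℝ) + 1) / 2) *
    (1 + ‖x‖ ^ 2) ^ (-((d : ℝ) + 1) / 2)

/-- The logarithmic moment `c_d` of the standard isotropic Cauchy density. -/
noncomputable def cD (d : ℕ) : ℝ :=
  ∫ x : EuclideanSpace ℝ (Fin d), pC d x * Real.log (1 + ‖x‖ ^ 2)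

theorem integrable_pC_mul_log (d : ℕ) :
    Integrable fun x : EuclideanSpace ℝ (Fin d) => pC d x * Real.log (1 + ‖x‖ ^ 2) := by
  have hdom : Integrable fun x : EuclideanSpace ℝ (Fin d) =>
      (1 + ‖x‖ ^ 2) ^ (-((d : ℝ) + 1 / 2) / 2) :=
    integrable_rpow_neg_one_add_norm_sq (by simp)
  have hprofile : Integrable fun x : EuclideanSpace ℝ (Fin d) =>
      (1 + ‖x‖ ^ 2) ^ (-((d : ℝ) + 1) / 2) * Real.log (1 + ‖x‖ ^ 2) := by
    refine (hdom.const_mul 4).mono' (by fun_prop) (ae_of_all _ fun x => ?_)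
    have hx : (1 : ℝ) ≤ 1 + ‖x‖ ^ 2 := by nlinarith [sq_nonneg ‖x‖]
    have hx0 : (0 : ℝ) < 1 + ‖x‖ ^ 2 := by positivity
    have hlog : Real.log (1 + ‖x‖ ^ 2) ≤ 4 * (1 + ‖x‖ ^ 2) ^ (1 / 4 : ℝ) := by
      have := Real.log_le_rpow_div hx0.le (show (0 : ℝ) < 1 / 4 by norm_num)
      linarith
    rw [Real.norm_of_nonneg (mul_nonneg (by positivity) (Real.log_nonneg hx))]
    calc (1 + ‖x‖ ^ 2) ^ (-((d : ℝ) + 1) / 2) * Real.log (1 + ‖x‖ ^ 2)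
        ≤ (1 + ‖x‖ ^ 2) ^ (-((d : ℝ) + 1) / 2) * (4 * (1 + ‖x‖ ^ 2) ^ (1 / 4 : ℝ)) := by
          gcongr
      _ = 4 * (1 + ‖x‖ ^ 2) ^ (-((d : ℝ) + 1 / 2) / 2) := by
          rw [mul_left_comm, ← Real.rpow_add hx0]
          ring_nf
  simpa only [pC, mul_assoc] using hprofile.const_mul
    (Real.Gamma (((d : ℝ) + 1) / 2) * Real.pi ^ (-((d : ℝ) + 1) / 2))

theorem pC_pos (d : ℕ) (x : EuclideanSpace ℝ (Fin d)) : 0 < pC d x := by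
  have : 0 < Real.Gamma (((d : ℝ) + 1) / 2) := Real.Gamma_pos_of_pos (by positivity)
  unfold pC
  positivity

theorem cD_pos {d : ℕ} (hd : 1 ≤ d) : 0 < cD d := by
  have hne (x : EuclideanSpace ℝ (Fin d)) : 1 + ‖x‖ ^ 2 ≠ 0 := by positivity
  have hcont : Continuous fun x : EuclideanSpace ℝ (Fin d) =>
      pC d x * Real.log (1 + ‖x‖ ^ 2) := by
    unfold pC
    exact (continuous_const.mul ((by fun_prop : Continuous fun x : EuclideanSpace ℝ (Fin d) =>
      1 + ‖x‖ ^ 2).rpow_const fun x => Or.inl (hne x))).mul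
      ((by fun_prop : Continuous fun x : EuclideanSpace ℝ (Fin d) => 1 + ‖x‖ ^ 2).log hne)
  refine integral_pos_of_integrable_nonneg_nonzero
    (x := EuclideanSpace.single (⟨0, hd⟩ : Fin d) (1 : ℝ)) hcont (integrable_pC_mul_log d)
    (fun x => mul_nonneg (pC_pos d x).le (Real.log_nonneg (by simp))) ?_
  refine mul_ne_zero (pC_pos d _).ne' (Real.log_pos ?_).ne'
  simp

theorem exists_pos_measure_le_norm {Ω E : Type*} [MeasurableSpace Ω] {μ : Measure Ω}
    [NormedAddCommGroup E] {X : Ω → E} (hne : 0 < μ {ω | X ω ≠ 0}) :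
    ∃ ε : ℝ, 0 < ε ∧ 0 < μ {ω | ε ≤ ‖X ω‖} := by
  have hU : {ω | X ω ≠ 0} ⊆ ⋃ n : ℕ, {ω | 1 / ((n : ℝ) + 1) ≤ ‖X ω‖} := fun ω hω => by
    obtain ⟨n, hn⟩ := exists_nat_one_div_lt (norm_pos_iff.mpr hω)
    exact Set.mem_iUnion.mpr ⟨n, hn.le⟩
  obtain ⟨n, hn⟩ := exists_measure_pos_of_not_measure_iUnion_null
    (hne.trans_le (measure_mono hU)).ne'
  exact ⟨_, Nat.one_div_pos_of_nat, hn⟩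

section LogMoment

variable {Ω E : Type*} [MeasurableSpace Ω] {μ : Measure Ω} [NormedAddCommGroup E]
  [MeasurableSpace E] [BorelSpace E] {X : Ω → E}

theorem measurable_log_one_add_sq_div (hX : Measurable X) (P : ℝ) :
    Measurable fun ω => Real.log (1 + ‖X ω‖ ^ 2 / P ^ 2) := by
  fun_prop

theorem log_one_add_sq_div_nonneg (x P : ℝ) : 0 ≤ Real.log (1 + x ^ 2 / P ^ 2) :=
  Real.log_nonneg (le_add_of_nonneg_right (by positivity))

theorem log_one_add_sq_div_anti (x : ℝ) {P Q : ℝ} (hP : 0 < P) (hPQ : P ≤ Q) :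
    Real.log (1 + x ^ 2 / Q ^ 2) ≤ Real.log (1 + x ^ 2 / P ^ 2) := by
  gcongr

theorem log_one_add_sq_div_strictAnti {x : ℝ} (hx : x ≠ 0) {P Q : ℝ} (hP : 0 < P)
    (hPQ : P < Q) : Real.log (1 + x ^ 2 / Q ^ 2) < Real.log (1 + x ^ 2 / P ^ 2) := by
  have hx2 : 0 < x ^ 2 := by positivity
  gcongr

theorem log_one_add_sq_div_le {x P : ℝ} (hx : 0 ≤ x) (hP : 0 < P) :
    Real.log (1 + x ^ 2 / P ^ 2) ≤ 2 * (Real.log (1 + x) + Real.log (1 + 1 / P)) := by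
  rw [← Real.log_mul (by positivity) (by positivity), ← Nat.cast_ofNat (R := ℝ) (n := 2),
    ← Real.log_pow]
  refine Real.log_le_log (by positivity) ?_
  have h1 : 1 + x ^ 2 / P ^ 2 ≤ (1 + x / P) ^ 2 := by
    have : 0 ≤ x / P := by positivity
    rw [← div_pow]
    nlinarith
  have h2 : 1 + x / P ≤ (1 + x) * (1 + 1 / P) := by
    have : 0 ≤ 1 / P := by positivity
    have h : x / P = x * (1 / P) := by ring
    nlinarith
  exact h1.trans (pow_le_pow_left₀ (by positivity) h2 2)

theorem integrable_log_one_add_sq_div [IsFiniteMeasure μ] (hX : Measurable X)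
    (hlog : Integrable (fun ω => Real.log (1 + ‖X ω‖)) μ) {P : ℝ} (hP : 0 < P) :
    Integrable (fun ω => Real.log (1 + ‖X ω‖ ^ 2 / P ^ 2)) μ := by
  refine ((hlog.add (integrable_const (Real.log (1 + 1 / P)))).const_mul 2).mono'
    (measurable_log_one_add_sq_div hX P).aestronglyMeasurable (ae_of_all _ fun ω => ?_)
  rw [Real.norm_of_nonneg (log_one_add_sq_div_nonneg _ _)]
  exact log_one_add_sq_div_le (norm_nonneg _) hP

theorem continuousOn_integral_log_one_add_sq_div [IsFiniteMeasure μ] (hX : Measurable X)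
    (hlog : Integrable (fun ω => Real.log (1 + ‖X ω‖)) μ) :
    ContinuousOn (fun P : ℝ => ∫ ω, Real.log (1 + ‖X ω‖ ^ 2 / P ^ 2) ∂μ) (Set.Ioi 0) := by
  intro P (hP : 0 < P)
  refine (continuousAt_of_dominated
    (.of_forall fun Q => (measurable_log_one_add_sq_div hX Q).aestronglyMeasurable) ?_
    (integrable_log_one_add_sq_div hX hlog (half_pos hP))
    (ae_of_all _ fun ω => ?_)).continuousWithinAt
  · filter_upwards [lt_mem_nhds (half_lt_self hP)] with Q hQ
    refine ae_of_all _ fun ω => ?_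
    rw [Real.norm_of_nonneg (log_one_add_sq_div_nonneg _ _)]
    exact log_one_add_sq_div_anti _ (half_pos hP) hQ.le
  · have h1 : P ^ 2 ≠ 0 := by positivity
    have h2 : 1 + ‖X ω‖ ^ 2 / P ^ 2 ≠ 0 := by positivity
    exact (continuousAt_const.add
      (continuousAt_const.div (continuousAt_id.pow 2) h1)).log h2

theorem strictAntiOn_integral_log_one_add_sq_div [IsFiniteMeasure μ] (hX : Measurable X)
    (hne : 0 < μ {ω | X ω ≠ 0}) (hlog : Integrable (fun ω => Real.log (1 + ‖X ω‖)) μ) :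
    StrictAntiOn (fun P : ℝ => ∫ ω, Real.log (1 + ‖X ω‖ ^ 2 / P ^ 2) ∂μ) (Set.Ioi 0) := by
  intro P (hP : 0 < P) Q (hQ : 0 < Q) hPQ
  have hintP := integrable_log_one_add_sq_div hX hlog hP
  have hintQ := integrable_log_one_add_sq_div hX hlog hQ
  rw [← sub_pos, ← integral_sub hintP hintQ]
  refine (integral_pos_iff_support_of_nonneg
    (fun ω => sub_nonneg.mpr (log_one_add_sq_div_anti _ hP hPQ.le)) (hintP.sub hintQ)).mpr
    (hne.trans_le (measure_mono fun ω hω => ?_))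
  exact (sub_pos.mpr (log_one_add_sq_div_strictAnti (norm_ne_zero_iff.mpr hω) hP hPQ)).ne'

theorem tendsto_integral_log_one_add_sq_div_nhdsGT_zero [IsFiniteMeasure μ] (hX : Measurable X)
    (hne : 0 < μ {ω | X ω ≠ 0}) (hlog : Integrable (fun ω => Real.log (1 + ‖X ω‖)) μ) :
    Tendsto (fun P : ℝ => ∫ ω, Real.log (1 + ‖X ω‖ ^ 2 / P ^ 2) ∂μ) (𝓝[>] 0) atTop := by
  obtain ⟨ε, hε, hμ⟩ := exists_pos_measure_le_norm hne
  have hm : 0 < μ.real {ω | ε ≤ ‖X ω‖} := ENNReal.toReal_pos hμ.ne' (measure_ne_top _ _)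
  have hlim : Tendsto (fun P : ℝ => 1 + ε ^ 2 / P ^ 2) (𝓝[>] 0) atTop := by
    have h := (tendsto_pow_atTop (α := ℝ) two_ne_zero).comp tendsto_inv_nhdsGT_zero
    refine tendsto_atTop_add_const_left _ 1
      ((h.const_mul_atTop (show 0 < ε ^ 2 by positivity)).congr fun P => ?_)
    simp [div_eq_mul_inv]
  refine tendsto_atTop_mono' _ ?_
    ((Real.tendsto_log_atTop.comp hlim).atTop_mul_const hm)
  filter_upwards [self_mem_nhdsWithin] with P (hP : 0 < P)
  refine le_trans ?_ (mul_meas_ge_le_integral_of_nonneg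
    (ae_of_all _ fun ω => log_one_add_sq_div_nonneg _ _)
    (integrable_log_one_add_sq_div hX hlog hP) (Real.log (1 + ε ^ 2 / P ^ 2)))
  refine mul_le_mul_of_nonneg_left (measureReal_mono fun ω (hω : ε ≤ ‖X ω‖) => ?_)
    (log_one_add_sq_div_nonneg _ _)
  change Real.log _ ≤ Real.log _
  gcongr

theorem tendsto_integral_log_one_add_sq_div_atTop [IsFiniteMeasure μ] (hX : Measurable X)
    (hlog : Integrable (fun ω => Real.log (1 + ‖X ω‖)) μ) :
    Tendsto (fun P : ℝ => ∫ ω, Real.log (1 + ‖X ω‖ ^ 2 / P ^ 2) ∂μ) atTop (𝓝 0) := by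
  rw [← integral_zero Ω ℝ (μ := μ)]
  refine tendsto_integral_filter_of_dominated_convergence
    (fun ω => Real.log (1 + ‖X ω‖ ^ 2 / 1 ^ 2))
    (.of_forall fun P => (measurable_log_one_add_sq_div hX P).aestronglyMeasurable) ?_
    (integrable_log_one_add_sq_div hX hlog one_pos) (ae_of_all _ fun ω => ?_)
  · filter_upwards [eventually_ge_atTop 1] with P hP
    refine ae_of_all _ fun ω => ?_
    rw [Real.norm_of_nonneg (log_one_add_sq_div_nonneg _ _)]
    exact log_one_add_sq_div_anti _ one_pos hP
  · have h : Tendsto (fun P : ℝ => 1 + ‖X ω‖ ^ 2 / P ^ 2) atTop (𝓝 (1 + 0)) :=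
      tendsto_const_nhds.add
        (tendsto_const_nhds.div_atTop (tendsto_pow_atTop two_ne_zero))
    simpa using h.log (by norm_num)

end LogMoment

/-- Existence and uniqueness of the `1`-power: for a non-degenerate `X` with finite
logarithmic moment, `g(P) = E[ln(1+‖X‖²/P²)]` is continuous and strictly decreasing
on `(0,∞)`, tends to `+∞` at `0⁺` and to `0` at `+∞`, and there is a unique `P* > 0`
with `g(P*) = c_d`. -/
theorem stmt14 (d : ℕ) (hd : 1 ≤ d)
    {Ω : Type} [MeasurableSpace Ω] (μ : Measure Ω) [IsProbabilityMeasure μ]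
    (X : Ω → EuclideanSpace ℝ (Fin d)) (hX : Measurable X)
    (hne : 0 < μ {ω | X ω ≠ 0})
    (hlog : Integrable (fun ω => Real.log (1 + ‖X ω‖)) μ) :
    ContinuousOn (fun P : ℝ => ∫ ω, Real.log (1 + ‖X ω‖ ^ 2 / P ^ 2) ∂μ) (Set.Ioi 0) ∧
    StrictAntiOn (fun P : ℝ => ∫ ω, Real.log (1 + ‖X ω‖ ^ 2 / P ^ 2) ∂μ) (Set.Ioi 0) ∧
    Tendsto (fun P : ℝ => ∫ ω, Real.log (1 + ‖X ω‖ ^ 2 / P ^ 2) ∂μ)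
      (nhdsWithin 0 (Set.Ioi 0)) atTop ∧
    Tendsto (fun P : ℝ => ∫ ω, Real.log (1 + ‖X ω‖ ^ 2 / P ^ 2) ∂μ) atTop (nhds 0) ∧
    ∃! P : ℝ, 0 < P ∧ ∫ ω, Real.log (1 + ‖X ω‖ ^ 2 / P ^ 2) ∂μ = cD d := by
  have hcont := continuousOn_integral_log_one_add_sq_div hX hlog
  have hanti := strictAntiOn_integral_log_one_add_sq_div hX hne hlog
  have hzero := tendsto_integral_log_one_add_sq_div_nhdsGT_zero hX hne hlog
  have htop := tendsto_integral_log_one_add_sq_div_atTop hX hlog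
  refine ⟨hcont, hanti, hzero, htop, ?_⟩
  obtain ⟨a, ha, ha0⟩ := ((hzero.eventually_ge_atTop (cD d)).and self_mem_nhdsWithin).exists
  obtain ⟨b, hb, hb0⟩ :=
    ((htop.eventually_le_const (cD_pos hd)).and (eventually_gt_atTop 0)).exists
  obtain ⟨P, hP, hPc⟩ := isPreconnected_Ioi.intermediate_value hb0 ha0 hcont ⟨hb, ha⟩
  exact ⟨P, ⟨hP, hPc⟩, fun Q hQ => hanti.injOn hQ.1 hP (hQ.2.trans hPc.symm)⟩
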